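/- Fix β ∈ (0,1), α = √(1−β²), x₁, x₂ ∈ ℝ with x₁ ≠ (π/α)(1/2+k) for every integer k. Let B, Bₜ be the breather profile and K, Kₜ the complex-valued kink profile with the same parameters (β, x₁, x₂). Then: (1) lim_{x→+∞} cos((B(x)+K(x))/2) = −1, lim_{x→−∞} cos((B(x)+K(x))/2) = 1, lim_{x→+∞} cos((B(x)−K(x))/2) = −1, lim_{x→−∞} cos((B(x)−K(x))/2) = 1; (2) for all x ∈ ℝ: B′(x) − Kₜ(x) = (1/(β+iα))·sin((B(x)+K(x))/2) + (β+iα)·sin((B(x)−K(x))/2) and Bₜ(x) − K′(x) = (1/(β+iα))·sin((B(x)+K(x))/2) − (β+iα)·sin((B(x)−K(x))/2); i.e. (B, Bₜ) is a Bäcklund transform of (K, Kₜ) with complex parameter β + iα. -/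

import Mathlib

open Filter Complex Topology

namespace Complex

theorem exp_two_mul_arctan_mul_I {z : ℂ} (hz : 1 + z ^ 2 ≠ 0) :
    exp (2 * arctan z * I) = (1 + z * I) / (1 - z * I) := by
  have hfac : (1 + z * I) * (1 - z * I) ≠ 0 := by
    have h : (1 + z * I) * (1 - z * I) = 1 + z ^ 2 := by linear_combination -z ^ 2 * I_sq
    rwa [h]
  have h : 2 * arctan z * I = log ((1 + z * I) / (1 - z * I)) := by
    rw [arctan]
    linear_combination -log ((1 + z * I) / (1 - z * I)) * I_sq
  rw [h, exp_log (div_ne_zero (left_ne_zero_of_mul hfac) (right_ne_zero_of_mul hfac))]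

theorem cos_two_mul_arctan {z : ℂ} (hz : 1 + z ^ 2 ≠ 0) :
    cos (2 * arctan z) = (1 - z ^ 2) / (1 + z ^ 2) := by
  have h : 1 + z ^ 2 = (1 + z * I) * (1 - z * I) := by linear_combination z ^ 2 * I_sq
  have hfac := h ▸ hz
  have h₁ := left_ne_zero_of_mul hfac
  have h₂ := right_ne_zero_of_mul hfac
  rw [cos, neg_mul, exp_neg, exp_two_mul_arctan_mul_I hz, h]
  field_simp
  linear_combination 2 * z ^ 2 * I_sq

theorem sin_two_mul_arctan {z : ℂ} (hz : 1 + z ^ 2 ≠ 0) :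
    sin (2 * arctan z) = 2 * z / (1 + z ^ 2) := by
  have h : 1 + z ^ 2 = (1 + z * I) * (1 - z * I) := by linear_combination z ^ 2 * I_sq
  have hfac := h ▸ hz
  have h₁ := left_ne_zero_of_mul hfac
  have h₂ := right_ne_zero_of_mul hfac
  rw [sin, neg_mul, exp_neg, exp_two_mul_arctan_mul_I hz, h]
  field_simp
  linear_combination -4 * z * I_sq

theorem one_add_exp_sq (z : ℂ) : 1 + exp z ^ 2 = 2 * exp z * cosh z := by
  have h : exp z * exp (-z) = 1 := by rw [← exp_add, add_neg_cancel, exp_zero]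
  rw [cosh]
  linear_combination -h

theorem one_sub_exp_sq (z : ℂ) : 1 - exp z ^ 2 = -(2 * exp z * sinh z) := by
  have h : exp z * exp (-z) = 1 := by rw [← exp_add, add_neg_cancel, exp_zero]
  rw [sinh]
  linear_combination -h

theorem one_add_exp_sq_ne_zero {z : ℂ} (hz : cosh z ≠ 0) : 1 + exp z ^ 2 ≠ 0 := by
  rw [one_add_exp_sq]
  exact mul_ne_zero (mul_ne_zero two_ne_zero (exp_ne_zero z)) hz

/-- The Gudermannian relation for the cosine. -/
theorem cos_two_mul_arctan_exp {z : ℂ} (hz : cosh z ≠ 0) :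
    cos (2 * arctan (exp z)) = -(sinh z / cosh z) := by
  have h := exp_ne_zero z
  rw [cos_two_mul_arctan (one_add_exp_sq_ne_zero hz), one_add_exp_sq, one_sub_exp_sq]
  field_simp

/-- The Gudermannian relation for the sine. -/
theorem sin_two_mul_arctan_exp {z : ℂ} (hz : cosh z ≠ 0) :
    sin (2 * arctan (exp z)) = 1 / cosh z := by
  have h := exp_ne_zero z
  rw [sin_two_mul_arctan (one_add_exp_sq_ne_zero hz), one_add_exp_sq]
  field_simp

theorem one_add_sq_ne_zero_of_re_ne_zero {z : ℂ} (hz : z.re ≠ 0) : 1 + z ^ 2 ≠ 0 := by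
  intro h
  have hre := congrArg re h
  have him := congrArg im h
  simp only [sq, add_re, one_re, mul_re, zero_re, add_im, one_im, mul_im, zero_im] at hre him
  have hy : z.im = 0 := by
    have : z.re * z.im = 0 := by linarith
    exact (mul_eq_zero.mp this).resolve_left hz
  rw [hy] at hre
  nlinarith [sq_nonneg z.re]

theorem hasDerivAt_arctan {z : ℂ} (hz : z.re ≠ 0) : HasDerivAt arctan (1 / (1 + z ^ 2)) z := by
  have hne := one_add_sq_ne_zero_of_re_ne_zero hz
  have h : 1 + z ^ 2 = (1 + z * I) * (1 - z * I) := by linear_combination z ^ 2 * I_sq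
  have hfac := h ▸ hne
  have h₁ := left_ne_zero_of_mul hfac
  have h₂ := right_ne_zero_of_mul hfac
  have hslit : (1 + z * I) / (1 - z * I) ∈ slitPlane := by
    right
    have hsq := normSq_pos.mpr h₂
    have him : ((1 + z * I) / (1 - z * I)).im = 2 * z.re / normSq (1 - z * I) := by
      rw [div_im]
      simp only [add_re, add_im, sub_re, sub_im, one_re, one_im, mul_re, mul_im, I_re, I_im]
      ring
    rw [him]
    exact div_ne_zero (mul_ne_zero two_ne_zero hz) hsq.ne'
  have hd := (((((hasDerivAt_id z).mul_const I).const_add 1).div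
    (((hasDerivAt_id z).mul_const I).const_sub 1) h₂).clog hslit).const_mul (-I / 2)
  refine hd.congr_deriv ?_
  have hsum : (1 + z * I) + (1 - z * I) = 2 := by ring
  simp only [id, Pi.div_apply]
  rw [h]
  generalize 1 + z * I = p at *
  generalize 1 - z * I = q at *
  field_simp
  linear_combination -I ^ 2 * hsum - 2 * I_sq

theorem tendsto_cos_two_mul_arctan_of_tendsto_zero {ι : Type*} {l : Filter ι} {w : ι → ℂ}
    (hw : Tendsto w l (𝓝 0)) (hne : ∀ i, 1 + w i ^ 2 ≠ 0) :
    Tendsto (fun i => cos (2 * arctan (w i))) l (𝓝 1) := by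
  simp_rw [fun i => cos_two_mul_arctan (hne i)]
  simpa [Pi.div_def] using ((hw.pow 2).const_sub 1).div ((hw.pow 2).const_add 1) (by simp)

theorem tendsto_sin_two_mul_arctan_of_tendsto_zero {ι : Type*} {l : Filter ι} {w : ι → ℂ}
    (hw : Tendsto w l (𝓝 0)) (hne : ∀ i, 1 + w i ^ 2 ≠ 0) :
    Tendsto (fun i => sin (2 * arctan (w i))) l (𝓝 0) := by
  simp_rw [fun i => sin_two_mul_arctan (hne i)]
  simpa [Pi.div_def] using (hw.const_mul 2).div ((hw.pow 2).const_add 1) (by simp)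

theorem cosh_neg_ne_zero {z : ℂ} (hz : cosh z ≠ 0) : cosh (-z) ≠ 0 := by
  rwa [cosh_neg]

theorem cos_two_mul_arctan_exp_neg {z : ℂ} (hz : cosh z ≠ 0) :
    cos (2 * arctan (exp (-z))) = -cos (2 * arctan (exp z)) := by
  rw [cos_two_mul_arctan_exp (cosh_neg_ne_zero hz), cos_two_mul_arctan_exp hz, cosh_neg, sinh_neg]
  ring

theorem sin_two_mul_arctan_exp_neg {z : ℂ} (hz : cosh z ≠ 0) :
    sin (2 * arctan (exp (-z))) = sin (2 * arctan (exp z)) := by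
  rw [sin_two_mul_arctan_exp (cosh_neg_ne_zero hz), sin_two_mul_arctan_exp hz, cosh_neg]

end Complex

theorem Real.tendsto_cosh_atTop : Tendsto Real.cosh atTop atTop := by
  refine tendsto_atTop_mono (fun x => ?_) (Real.tendsto_exp_atTop.atTop_div_const two_pos)
  rw [Real.cosh_eq]
  linarith [Real.exp_pos (-x)]

theorem Real.tendsto_cosh_atBot : Tendsto Real.cosh atBot atTop := by
  simpa [Function.comp_def] using Real.tendsto_cosh_atTop.comp tendsto_neg_atBot_atTop

/-- **The breather as a Bäcklund transform of the complex kink (Proposition 4.4).**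
For `β ∈ (0,1)`, `α = √(1−β²)`, and nondegenerate `x₁`, the breather profile `(B, Bₜ)`
and the complex kink profile `(K, Kₜ)` with the same parameters satisfy
`cos((B±K)/2) → ∓1` as `x → ±∞`, and the Bäcklund equations with complex parameter
`β + iα`. -/
theorem breather_backlund_of_complex_kink (β x₁ x₂ : ℝ) (hβ0 : 0 < β) (hβ1 : β < 1)
    (α : ℝ) (hα : α = Real.sqrt (1 - β ^ 2))
    (hx₁ : ∀ k : ℤ, x₁ ≠ (Real.pi / α) * (1 / 2 + (k : ℝ)))
    (B Bt : ℝ → ℝ)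
    (hB : ∀ x : ℝ, B x
      = 4 * Real.arctan (β * Real.sin (α * x₁) / (α * Real.cosh (β * (x + x₂)))))
    (hBt : ∀ x : ℝ, Bt x
      = 4 * α ^ 2 * β * Real.cos (α * x₁) * Real.cosh (β * (x + x₂))
          / (α ^ 2 * (Real.cosh (β * (x + x₂))) ^ 2 + β ^ 2 * (Real.sin (α * x₁)) ^ 2))
    (θ : ℝ → ℂ)
    (hθ : ∀ x : ℝ, θ x = (β : ℂ) * ((x : ℂ) + (x₂ : ℂ)) + Complex.I * (α : ℂ) * (x₁ : ℂ))
    (K Kt : ℝ → ℂ)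
    (hK : ∀ x : ℝ, K x = 4 * Complex.arctan (Complex.exp (θ x)))
    (hKt : ∀ x : ℝ, Kt x
      = 4 * Complex.I * (α : ℂ) * Complex.exp (θ x) / (1 + Complex.exp (2 * θ x))) :
    -- (1) limits at ±∞
    (Tendsto (fun x : ℝ => Complex.cos (((B x : ℂ) + K x) / 2)) atTop (nhds (-1))) ∧
    (Tendsto (fun x : ℝ => Complex.cos (((B x : ℂ) + K x) / 2)) atBot (nhds 1)) ∧
    (Tendsto (fun x : ℝ => Complex.cos (((B x : ℂ) - K x) / 2)) atTop (nhds (-1))) ∧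
    (Tendsto (fun x : ℝ => Complex.cos (((B x : ℂ) - K x) / 2)) atBot (nhds 1)) ∧
    -- (2) Bäcklund equations with parameter β + iα
    (∀ x : ℝ, ((deriv B x : ℝ) : ℂ) - Kt x
      = (1 / ((β : ℂ) + Complex.I * (α : ℂ))) * Complex.sin (((B x : ℂ) + K x) / 2)
        + ((β : ℂ) + Complex.I * (α : ℂ)) * Complex.sin (((B x : ℂ) - K x) / 2)) ∧
    (∀ x : ℝ, (Bt x : ℂ) - deriv K x
      = (1 / ((β : ℂ) + Complex.I * (α : ℂ))) * Complex.sin (((B x : ℂ) + K x) / 2)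
        - ((β : ℂ) + Complex.I * (α : ℂ)) * Complex.sin (((B x : ℂ) - K x) / 2)) := by
  have hα0 : 0 < α := hα ▸ Real.sqrt_pos.mpr (by nlinarith)
  have hαβ : α ^ 2 + β ^ 2 = 1 := by
    rw [hα, Real.sq_sqrt (by nlinarith)]
    ring
  have hcos : Real.cos (α * x₁) ≠ 0 := by
    intro h
    obtain ⟨k, hk⟩ := Real.cos_eq_zero_iff.mp h
    apply hx₁ k
    field_simp
    linarith
  have hθre (x : ℝ) : (θ x).re = β * (x + x₂) := by simp [hθ]
  have hθim (x : ℝ) : (θ x).im = α * x₁ := by simp [hθ]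
  have hexp_re (x : ℝ) : (exp (θ x)).re ≠ 0 := by
    rw [exp_re, hθim]
    exact mul_ne_zero (Real.exp_ne_zero _) hcos
  have hne (x : ℝ) : 1 + exp (θ x) ^ 2 ≠ 0 := one_add_sq_ne_zero_of_re_ne_zero (hexp_re x)
  have hcosh (x : ℝ) : cosh (θ x) ≠ 0 := by
    have h := hne x
    rw [one_add_exp_sq] at h
    exact right_ne_zero_of_mul h
  have hK2 (x : ℝ) : K x / 2 = 2 * arctan (exp (θ x)) := by rw [hK]; ring
  have hcos_add (x : ℝ) : cos (((B x : ℂ) + K x) / 2)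
      = cos (B x / 2) * cos (2 * arctan (exp (θ x)))
        - sin (B x / 2) * sin (2 * arctan (exp (θ x))) := by
    rw [add_div, cos_add, hK2]
  have hcos_sub (x : ℝ) : cos (((B x : ℂ) - K x) / 2)
      = cos (B x / 2) * cos (2 * arctan (exp (θ x)))
        + sin (B x / 2) * sin (2 * arctan (exp (θ x))) := by
    rw [sub_div, cos_sub, hK2]
  have harg_top : Tendsto (fun x : ℝ => β * (x + x₂)) atTop atTop :=
    (tendsto_atTop_add_const_right _ x₂ tendsto_id).const_mul_atTop hβ0
  have harg_bot : Tendsto (fun x : ℝ => β * (x + x₂)) atBot atBot :=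
    (tendsto_atBot_add_const_right _ x₂ tendsto_id).const_mul_atBot hβ0
  have hB_lim {l : Filter ℝ} (h : Tendsto (fun x => Real.cosh (β * (x + x₂))) l atTop) :
      Tendsto (fun x => (B x : ℂ) / 2) l (𝓝 0) := by
    have hu := (h.const_mul_atTop hα0).const_div_atTop (β * Real.sin (α * x₁))
    have hB0 : Tendsto B l (𝓝 0) := by
      rw [funext hB]
      simpa using ((Real.continuous_arctan.tendsto 0).comp hu).const_mul 4
    simpa using ((continuous_ofReal.tendsto 0).comp hB0).div_const 2
  have hlim {l : Filter ℝ} {c : ℂ} (h : Tendsto (fun x => Real.cosh (β * (x + x₂))) l atTop)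
      (hc : Tendsto (fun x => cos (2 * arctan (exp (θ x)))) l (𝓝 c))
      (hs : Tendsto (fun x => sin (2 * arctan (exp (θ x)))) l (𝓝 0)) :
      Tendsto (fun x : ℝ => cos (((B x : ℂ) + K x) / 2)) l (𝓝 c) ∧
      Tendsto (fun x : ℝ => cos (((B x : ℂ) - K x) / 2)) l (𝓝 c) := by
    have hBc := (continuous_cos.tendsto 0).comp (hB_lim h)
    have hBs := (continuous_sin.tendsto 0).comp (hB_lim h)
    rw [funext hcos_add, funext hcos_sub]
    exact ⟨by simpa using (hBc.mul hc).sub (hBs.mul hs),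
      by simpa using (hBc.mul hc).add (hBs.mul hs)⟩
  have hexp_bot : Tendsto (fun x => exp (θ x)) atBot (𝓝 0) := by
    rw [tendsto_zero_iff_norm_tendsto_zero]
    simp_rw [norm_exp, hθre]
    exact Real.tendsto_exp_atBot.comp harg_bot
  have hexp_top : Tendsto (fun x => exp (-θ x)) atTop (𝓝 0) := by
    rw [tendsto_zero_iff_norm_tendsto_zero]
    simp_rw [norm_exp, neg_re, hθre]
    exact Real.tendsto_exp_neg_atTop_nhds_zero.comp harg_top
  have hne_neg (x : ℝ) : 1 + exp (-θ x) ^ 2 ≠ 0 :=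
    one_add_exp_sq_ne_zero (cosh_neg_ne_zero (hcosh x))
  have hbot := hlim (Real.tendsto_cosh_atBot.comp harg_bot)
    (tendsto_cos_two_mul_arctan_of_tendsto_zero hexp_bot hne)
    (tendsto_sin_two_mul_arctan_of_tendsto_zero hexp_bot hne)
  have htop := hlim (c := -1) (Real.tendsto_cosh_atTop.comp harg_top)
    (by simpa [cos_two_mul_arctan_exp_neg (hcosh _)] using
      (tendsto_cos_two_mul_arctan_of_tendsto_zero hexp_top hne_neg).neg)
    (by simpa [sin_two_mul_arctan_exp_neg (hcosh _)] using
      tendsto_sin_two_mul_arctan_of_tendsto_zero hexp_top hne_neg)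
  have hC (x : ℝ) : 0 < Real.cosh (β * (x + x₂)) := Real.cosh_pos _
  have hD (x : ℝ) : 0 < α ^ 2 * Real.cosh (β * (x + x₂)) ^ 2
      + β ^ 2 * Real.sin (α * x₁) ^ 2 := by
    have := hC x
    positivity
  have hB_deriv (x : ℝ) : deriv B x
      = -(4 * α * β ^ 2 * Real.sin (α * x₁) * Real.sinh (β * (x + x₂)))
        / (α ^ 2 * Real.cosh (β * (x + x₂)) ^ 2 + β ^ 2 * Real.sin (α * x₁) ^ 2) := by
    have h₁ := (((hasDerivAt_id x).add_const x₂).const_mul β).cosh.const_mul α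
    have h₂ := (((hasDerivAt_const x (β * Real.sin (α * x₁))).div h₁
      (mul_pos hα0 (hC x)).ne').arctan).const_mul 4
    rw [funext hB]
    refine h₂.deriv.trans ?_
    simp only [id, Pi.div_apply]
    have := hC x
    have := hD x
    field_simp
    ring
  have hK_deriv (x : ℝ) : deriv K x = 2 * β / cosh (θ x) := by
    have hθd : HasDerivAt θ β x := by
      rw [funext hθ]
      simpa using (((hasDerivAt_id x).ofReal_comp.add_const (x₂ : ℂ)).const_mul (β : ℂ)).add_const
        (I * (α : ℂ) * (x₁ : ℂ))
    have hd := ((hasDerivAt_arctan (hexp_re x)).comp x hθd.cexp).const_mul 4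
    have hexp := exp_ne_zero (θ x)
    have hch := hcosh x
    rw [funext hK]
    refine hd.deriv.trans ?_
    rw [one_add_exp_sq]
    field_simp
    ring
  have hKt' (x : ℝ) : Kt x = 2 * I * α / cosh (θ x) := by
    have hexp := exp_ne_zero (θ x)
    have hch := hcosh x
    rw [hKt, two_mul (θ x), exp_add, ← sq, one_add_exp_sq]
    field_simp
    ring
  have hB2 (x : ℝ) : (B x : ℂ) / 2 = 2 * arctan
      ((β * Real.sin (α * x₁) / (α * Real.cosh (β * (x + x₂))) : ℝ) : ℂ) := by
    rw [hB, ← ofReal_arctan]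
    push_cast
    ring
  have hu_ne (u : ℝ) : 1 + (u : ℂ) ^ 2 ≠ 0 := by
    exact_mod_cast (by positivity : (0 : ℝ) < 1 + u ^ 2).ne'
  have hαC : (α : ℂ) ≠ 0 := ofReal_ne_zero.mpr hα0.ne'
  have hCC (x : ℝ) : (Real.cosh (β * (x + x₂)) : ℂ) ≠ 0 := ofReal_ne_zero.mpr (hC x).ne'
  have hDC (x : ℝ) : (α : ℂ) ^ 2 * (Real.cosh (β * (x + x₂)) : ℂ) ^ 2
      + (β : ℂ) ^ 2 * (Real.sin (α * x₁) : ℂ) ^ 2 ≠ 0 := by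
    exact_mod_cast (hD x).ne'
  have hBsin (x : ℝ) : sin (B x / 2) = 2 * α * β * Real.sin (α * x₁) * Real.cosh (β * (x + x₂))
      / (α ^ 2 * Real.cosh (β * (x + x₂)) ^ 2 + β ^ 2 * Real.sin (α * x₁) ^ 2) := by
    have h := hu_ne (β * Real.sin (α * x₁) / (α * Real.cosh (β * (x + x₂))))
    have h₁ := hCC x
    have h₂ := hDC x
    rw [hB2, sin_two_mul_arctan h]
    simp only [ofReal_div, ofReal_mul] at h ⊢
    rw [div_eq_div_iff h h₂]
    field_simp
  have hBcos (x : ℝ) : cos (B x / 2)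
      = (α ^ 2 * Real.cosh (β * (x + x₂)) ^ 2 - β ^ 2 * Real.sin (α * x₁) ^ 2)
      / (α ^ 2 * Real.cosh (β * (x + x₂)) ^ 2 + β ^ 2 * Real.sin (α * x₁) ^ 2) := by
    have h := hu_ne (β * Real.sin (α * x₁) / (α * Real.cosh (β * (x + x₂))))
    have h₁ := hCC x
    have h₂ := hDC x
    rw [hB2, cos_two_mul_arctan h]
    simp only [ofReal_div, ofReal_mul] at h ⊢
    rw [div_eq_div_iff h h₂]
    field_simp
  have hinv : 1 / ((β : ℂ) + I * α) = β - I * α := by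
    have hmul : ((β : ℂ) + I * α) * (β - I * α) = 1 := by
      have h : (α : ℂ) ^ 2 + (β : ℂ) ^ 2 = 1 := by exact_mod_cast hαβ
      linear_combination h - (α : ℂ) ^ 2 * I_sq
    rw [one_div]
    exact inv_eq_of_mul_eq_one_right hmul
  have hθ' (x : ℝ) : θ x = ((β * (x + x₂) : ℝ) : ℂ) + ((α * x₁ : ℝ) : ℂ) * I := by
    rw [hθ]
    push_cast
    ring
  have hcosh_eq (x : ℝ) : cosh (θ x) = Real.cosh (β * (x + x₂)) * Real.cos (α * x₁)
      + Real.sinh (β * (x + x₂)) * Real.sin (α * x₁) * I := by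
    rw [hθ', cosh_add, cosh_mul_I, sinh_mul_I, ofReal_cosh, ofReal_cos, ofReal_sinh, ofReal_sin]
    ring
  have hsinh_eq (x : ℝ) : sinh (θ x) = Real.sinh (β * (x + x₂)) * Real.cos (α * x₁)
      + Real.cosh (β * (x + x₂)) * Real.sin (α * x₁) * I := by
    rw [hθ', sinh_add, cosh_mul_I, sinh_mul_I, ofReal_cosh, ofReal_cos, ofReal_sinh, ofReal_sin]
    ring
  have hCS (x : ℝ) : (Real.cosh (β * (x + x₂)) : ℂ) ^ 2 - (Real.sinh (β * (x + x₂)) : ℂ) ^ 2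
      = 1 := by exact_mod_cast Real.cosh_sq_sub_sinh_sq (β * (x + x₂))
  have hcs : (Real.sin (α * x₁) : ℂ) ^ 2 + (Real.cos (α * x₁) : ℂ) ^ 2 = 1 := by
    exact_mod_cast Real.sin_sq_add_cos_sq (α * x₁)
  refine ⟨htop.1, hbot.1, htop.2, hbot.2, fun x => ?_, fun x => ?_⟩
  · have hch := hcosh x
    have hDx := hDC x
    have key : Real.cosh (β * (x + x₂)) * sinh (θ x) - Real.sinh (β * (x + x₂)) * cosh (θ x)
        = I * Real.sin (α * x₁) := by
      rw [hcosh_eq, hsinh_eq]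
      linear_combination I * Real.sin (α * x₁) * hCS x
    rw [hinv, hB_deriv, hKt', add_div, sub_div, sin_add, sin_sub, hK2, hBsin, hBcos,
      cos_two_mul_arctan_exp hch, sin_two_mul_arctan_exp hch]
    simp only [ofReal_div, ofReal_mul, ofReal_add, ofReal_neg, ofReal_pow, ofReal_ofNat] at hDx ⊢
    generalize cosh (θ x) = ch at *
    generalize sinh (θ x) = sh at *
    generalize (Real.cosh (β * (x + x₂)) : ℂ) = C at *
    generalize (Real.sinh (β * (x + x₂)) : ℂ) = S at *
    generalize (Real.sin (α * x₁) : ℂ) = s at *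
    field_simp
    linear_combination 4 * (α : ℂ) * (β : ℂ) ^ 2 * s * key
  · have hch := hcosh x
    have hDx := hDC x
    have key : Real.cos (α * x₁) * cosh (θ x) - I * Real.sin (α * x₁) * sinh (θ x)
        = Real.cosh (β * (x + x₂)) := by
      rw [hcosh_eq, hsinh_eq]
      linear_combination (Real.cosh (β * (x + x₂)) : ℂ) * hcs
        - (Real.sin (α * x₁) : ℂ) ^ 2 * Real.cosh (β * (x + x₂)) * I_sq
    rw [hinv, hBt, hK_deriv, add_div, sub_div, sin_add, sin_sub, hK2, hBsin, hBcos,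
      cos_two_mul_arctan_exp hch, sin_two_mul_arctan_exp hch]
    simp only [ofReal_div, ofReal_mul, ofReal_add, ofReal_pow, ofReal_ofNat] at hDx ⊢
    generalize cosh (θ x) = ch at *
    generalize sinh (θ x) = sh at *
    generalize (Real.cosh (β * (x + x₂)) : ℂ) = C at *
    generalize (Real.sin (α * x₁) : ℂ) = s at *
    generalize (Real.cos (α * x₁) : ℂ) = c at *
    field_simp
    linear_combination 4 * (α : ℂ) ^ 2 * β * C * key
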